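/- arXiv:2309.11185 — 2 statements merged into one kernel-verified Lean document; each statement's English description precedes it below -/
import Mathlib

section
/- (Moments at weak non-Hermiticity.) For every real α > 0 and every integer p ≥ 0: (1/(2α√π)) · ∫_{−2}^{2} x^{2p} · erf((α/2)·√(4−x²)) dx = (1/π) · Σ_{n=0}^{∞} (2^{2p+1}/(2n+1)) · (Γ(n+3/2)·Γ(p+1/2)/(n!·(n+p+1)!)) · (−α²)^n, where the series on the right converges absolutely. -/
open Real MeasureTheory Finset

/-- The error function `erf(z) = (2/√π)·∫_0^z e^{−s²} ds`. -/
noncomputable def erf (z : ℝ) : ℝ :=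
  (2/Real.sqrt Real.pi) * ∫ s in (0:ℝ)..z, Real.exp (-s^2)

/-- The Maclaurin series of the error function. -/
theorem hasSum_erf (z : ℝ) :
    HasSum (fun n : ℕ => (2 / √π) * ((-1) ^ n / ((n.factorial : ℝ) * (2 * n + 1)) * z ^ (2 * n + 1)))
      (erf z) := by
  have hexp (s : ℝ) : HasSum (fun n : ℕ => (-s ^ 2) ^ n / (n.factorial : ℝ)) (exp (-s ^ 2)) := by
    rw [Real.exp_eq_exp_ℝ]
    exact NormedSpace.expSeries_div_hasSum_exp _
  have hbound : Summable (fun n : ℕ => (z ^ 2) ^ n / (n.factorial : ℝ)) :=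
    Real.summable_pow_div_factorial _
  have hint : HasSum (fun n : ℕ => ∫ s in (0 : ℝ)..z, (-s ^ 2) ^ n / (n.factorial : ℝ))
      (∫ s in (0 : ℝ)..z, exp (-s ^ 2)) := by
    refine intervalIntegral.hasSum_integral_of_dominated_convergence
      (fun n _ => (z ^ 2) ^ n / (n.factorial : ℝ)) (fun n => ?_) (fun n => ?_) ?_ ?_ ?_
    · exact Continuous.aestronglyMeasurable (by fun_prop)
    · refine ae_of_all _ fun s hs => ?_
      have hsz : s ^ 2 ≤ z ^ 2 := by
        rcases Set.mem_uIoc.mp hs with h | h <;> nlinarith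
      rw [norm_div, norm_pow, norm_neg, Real.norm_of_nonneg (sq_nonneg s),
        Real.norm_of_nonneg (Nat.cast_nonneg _)]
      gcongr
    · exact ae_of_all _ fun _ _ => hbound
    · exact intervalIntegrable_const
    · exact ae_of_all _ fun s _ => hexp s
  refine (hint.mul_left (2 / √π)).congr_fun fun n => ?_
  have hmonomial (s : ℝ) :
      (-s ^ 2) ^ n / (n.factorial : ℝ) = ((-1) ^ n / (n.factorial : ℝ)) * s ^ (2 * n) := by
    rw [neg_pow, pow_mul]
    ring
  simp_rw [hmonomial]
  rw [intervalIntegral.integral_const_mul, integral_pow]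
  push_cast
  have : (n.factorial : ℝ) ≠ 0 := by positivity
  field_simp
  simp

/-- Euler's integral of the first kind for real parameters. -/
theorem integral_Ioo_rpow_mul_one_sub_rpow {a b : ℝ} (ha : 0 < a) (hb : 0 < b) :
    ∫ t in Set.Ioo (0 : ℝ) 1, t ^ (a - 1) * (1 - t) ^ (b - 1)
      = Gamma a * Gamma b / Gamma (a + b) := by
  have hbeta := ProbabilityTheory.beta_eq_betaIntegralReal a b ha hb
  rw [ProbabilityTheory.beta] at hbeta
  have hreal : Complex.betaIntegral a b
      = ((∫ t in Set.Ioo (0 : ℝ) 1, t ^ (a - 1) * (1 - t) ^ (b - 1) : ℝ) : ℂ) := by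
    rw [Complex.betaIntegral, intervalIntegral.integral_of_le zero_le_one,
      integral_Ioc_eq_integral_Ioo, ← integral_complex_ofReal]
    refine setIntegral_congr_fun measurableSet_Ioo fun t ht => ?_
    push_cast [Complex.ofReal_cpow ht.1.le, Complex.ofReal_cpow (sub_pos.mpr ht.2).le]
    rfl
  rw [hbeta, hreal, Complex.ofReal_re]

/-- Even moments of the odd powers of the semicircle. -/
theorem integral_pow_mul_sqrt_four_sub_sq_pow (p n : ℕ) :
    ∫ x in (-2 : ℝ)..2, x ^ (2 * p) * √(4 - x ^ 2) ^ (2 * n + 1)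
      = 2 ^ (2 * p + 2 * n + 2) *
        (Gamma (n + 3 / 2) * Gamma (p + 1 / 2) / ((n + p + 1).factorial : ℝ)) := by
  set f : ℝ → ℝ := fun x => x ^ (2 * p) * √(4 - x ^ 2) ^ (2 * n + 1) with hf
  have hcont : Continuous f := by fun_prop
  have heven : ∫ x in (-2 : ℝ)..0, f x = ∫ x in (0 : ℝ)..2, f x := by
    rw [← neg_zero, ← intervalIntegral.integral_comp_neg]
    simp [hf, pow_mul]
  have himage : (fun x : ℝ => x ^ 2 / 4) '' Set.Ioo 0 2 = Set.Ioo 0 1 := by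
    ext t
    constructor
    · rintro ⟨x, ⟨hx0, hx2⟩, rfl⟩
      constructor <;> dsimp only <;> nlinarith
    · rintro ⟨ht0, ht1⟩
      refine ⟨2 * √t, ⟨by positivity, ?_⟩, ?_⟩
      · have : √t < 1 := by rwa [Real.sqrt_lt' one_pos, one_pow]
        linarith
      · dsimp only
        rw [mul_pow, Real.sq_sqrt ht0.le]
        ring
  have hsubst := integral_image_eq_integral_abs_deriv_smul (s := Set.Ioo (0 : ℝ) 2)
    (f := fun x => x ^ 2 / 4) (f' := fun x => x / 2) measurableSet_Ioo
    (fun x _ => by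
      have h := ((hasDerivAt_pow 2 x).div_const 4).hasDerivWithinAt (s := Set.Ioo (0 : ℝ) 2)
      exact h.congr_deriv (by norm_num; ring))
    (fun x hx y hy hxy => by
      have := hx.1
      have := hy.1
      dsimp only at hxy
      nlinarith)
    (fun t => t ^ ((p : ℝ) + 1 / 2 - 1) * (1 - t) ^ ((n : ℝ) + 3 / 2 - 1))
  rw [himage, integral_Ioo_rpow_mul_one_sub_rpow (by positivity) (by positivity)] at hsubst
  have hhalf : ∫ x in (0 : ℝ)..2, f x = 2 ^ (2 * p + 2 * n + 1) *
      (Gamma (p + 1 / 2) * Gamma (n + 3 / 2) / Gamma (p + 1 / 2 + (n + 3 / 2))) := by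
    rw [hsubst, intervalIntegral.integral_of_le zero_le_two, integral_Ioc_eq_integral_Ioo,
      ← integral_const_mul]
    refine setIntegral_congr_fun measurableSet_Ioo fun x hx => ?_
    have hx0 : 0 < x / 2 := half_pos hx.1
    have hy : 0 < 4 - x ^ 2 := by nlinarith [hx.1, hx.2]
    have hy0 : 0 < √(4 - x ^ 2) / 2 := by positivity
    have hleft : (x ^ 2 / 4) ^ ((p : ℝ) + 1 / 2 - 1) * (x / 2) = (x / 2) ^ (2 * p) := by
      rw [show x ^ 2 / 4 = (x / 2) ^ (2 : ℝ) by rw [Real.rpow_two]; ring, ← Real.rpow_mul hx0.le,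
        ← Real.rpow_add_one hx0.ne', ← Real.rpow_natCast]
      congr 1
      push_cast
      ring
    have hright : (1 - x ^ 2 / 4) ^ ((n : ℝ) + 3 / 2 - 1) = (√(4 - x ^ 2) / 2) ^ (2 * n + 1) := by
      rw [show 1 - x ^ 2 / 4 = (√(4 - x ^ 2) / 2) ^ (2 : ℝ) by
          rw [Real.rpow_two, div_pow, Real.sq_sqrt hy.le]; ring,
        ← Real.rpow_mul hy0.le, ← Real.rpow_natCast (√(4 - x ^ 2) / 2)]
      congr 1
      push_cast
      ring
    simp only [hf, smul_eq_mul, abs_of_pos hx0, hright]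
    calc x ^ (2 * p) * √(4 - x ^ 2) ^ (2 * n + 1)
        = 2 ^ (2 * p + 2 * n + 1) * ((x / 2) ^ (2 * p) * (√(4 - x ^ 2) / 2) ^ (2 * n + 1)) := by
          rw [div_pow, div_pow, show 2 * p + 2 * n + 1 = 2 * p + (2 * n + 1) by ring,
            pow_add (2 : ℝ) (2 * p)]
          field_simp
      _ = _ := by
          rw [← hleft]
          ring
  rw [← intervalIntegral.integral_add_adjacent_intervals
      (hcont.intervalIntegrable (-2) 0) (hcont.intervalIntegrable 0 2), heven, hhalf,
    show (p : ℝ) + 1 / 2 + (n + 3 / 2) = ((n + p + 1 : ℕ) : ℝ) + 1 by push_cast; ring,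
    Real.Gamma_nat_eq_factorial]
  ring

/-- Termwise integration of the Maclaurin series of `erf` against an even monomial. -/
theorem hasSum_integral_pow_mul_erf (α : ℝ) (p : ℕ) :
    HasSum (fun n : ℕ => ∫ x in (-2 : ℝ)..2, x ^ (2 * p) *
        ((2 / √π) * ((-1) ^ n / ((n.factorial : ℝ) * (2 * n + 1)) *
          ((α / 2) * √(4 - x ^ 2)) ^ (2 * n + 1))))
      (∫ x in (-2 : ℝ)..2, x ^ (2 * p) * erf ((α / 2) * √(4 - x ^ 2))) := by
  have hbound : Summable (fun n : ℕ =>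
      2 ^ (2 * p) * ((2 / √π) * (|α| * ((α ^ 2) ^ n / (n.factorial : ℝ))))) :=
    (((Real.summable_pow_div_factorial _).mul_left _).mul_left _).mul_left _
  refine intervalIntegral.hasSum_integral_of_dominated_convergence
    (fun n _ => 2 ^ (2 * p) * ((2 / √π) * (|α| * ((α ^ 2) ^ n / (n.factorial : ℝ)))))
    (fun n => ?_) (fun n => ?_) ?_ ?_ ?_
  · exact Continuous.aestronglyMeasurable (by fun_prop)
  · refine ae_of_all _ fun x hx => ?_
    rw [Set.uIoc_of_le (by norm_num)] at hx
    have hx2 : |x| ≤ 2 := abs_le.mpr ⟨hx.1.le, hx.2⟩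
    have hsqrt : √(4 - x ^ 2) ≤ 2 := by
      rw [Real.sqrt_le_left zero_le_two]
      nlinarith [sq_nonneg x]
    have hz : |α / 2 * √(4 - x ^ 2)| ≤ |α| := by
      rw [abs_mul, abs_div, abs_two, abs_of_nonneg (Real.sqrt_nonneg _)]
      nlinarith [abs_nonneg α]
    have hcoeff : |(-1 : ℝ) ^ n / ((n.factorial : ℝ) * (2 * n + 1))| ≤ 1 / (n.factorial : ℝ) := by
      rw [abs_div, abs_pow, abs_neg, abs_one, one_pow, abs_of_nonneg (by positivity)]
      gcongr
      exact le_mul_of_one_le_right (by positivity) (by linarith [n.cast_nonneg (α := ℝ)])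
    calc ‖x ^ (2 * p) * ((2 / √π) * ((-1) ^ n / ((n.factorial : ℝ) * (2 * n + 1)) *
          ((α / 2) * √(4 - x ^ 2)) ^ (2 * n + 1)))‖
        = |x| ^ (2 * p) * ((2 / √π) * (|(-1 : ℝ) ^ n / ((n.factorial : ℝ) * (2 * n + 1))| *
          |(α / 2) * √(4 - x ^ 2)| ^ (2 * n + 1))) := by
          rw [Real.norm_eq_abs, abs_mul, abs_mul, abs_mul, abs_pow, abs_pow,
            abs_of_nonneg (show 0 ≤ 2 / √π by positivity)]
      _ ≤ 2 ^ (2 * p) * ((2 / √π) * (1 / (n.factorial : ℝ) * |α| ^ (2 * n + 1))) := by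
          gcongr
      _ = _ := by
          rw [pow_succ, pow_mul |α|, sq_abs]
          ring
  · exact ae_of_all _ fun _ _ => hbound
  · exact intervalIntegrable_const
  · exact ae_of_all _ fun x _ => (hasSum_erf _).mul_left _

/-- **Theorem (Moments at weak non-Hermiticity).**
For every real `α > 0` and every integer `p ≥ 0`,
`(1/(2α√π))·∫_{−2}^{2} x^{2p}·erf((α/2)√(4−x²)) dx
  = (1/π)·Σ_{n=0}^{∞} (2^{2p+1}/(2n+1))·(Γ(n+3/2)Γ(p+1/2)/(n!(n+p+1)!))·(−α²)^n`,
and the series on the right converges absolutely. -/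
theorem weak_nonHermiticity_moments (α : ℝ) (hα : 0 < α) (p : ℕ) :
    Summable (fun n : ℕ =>
      |(2^(2*p+1)/(2*(n:ℝ)+1)) *
        (Real.Gamma ((n:ℝ)+3/2) * Real.Gamma ((p:ℝ)+1/2) /
          ((Nat.factorial n : ℝ) * (Nat.factorial (n+p+1) : ℝ))) * (-α^2)^n|) ∧
    (1/(2*α*Real.sqrt Real.pi)) *
        (∫ x in (-2:ℝ)..2, x^(2*p) * erf ((α/2) * Real.sqrt (4-x^2)))
      = (1/Real.pi) * ∑' n : ℕ,
          (2^(2*p+1)/(2*(n:ℝ)+1)) *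
            (Real.Gamma ((n:ℝ)+3/2) * Real.Gamma ((p:ℝ)+1/2) /
              ((Nat.factorial n : ℝ) * (Nat.factorial (n+p+1) : ℝ))) * (-α^2)^n := by
  have hterm (n : ℕ) : π * (1 / (2 * α * √π) * ∫ x in (-2 : ℝ)..2, x ^ (2 * p) *
        ((2 / √π) * ((-1) ^ n / ((n.factorial : ℝ) * (2 * n + 1)) *
          ((α / 2) * √(4 - x ^ 2)) ^ (2 * n + 1))))
      = (2^(2*p+1)/(2*(n:ℝ)+1)) *
        (Real.Gamma ((n:ℝ)+3/2) * Real.Gamma ((p:ℝ)+1/2) /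
          ((Nat.factorial n : ℝ) * (Nat.factorial (n+p+1) : ℝ))) * (-α^2)^n := by
    have hfactor (x : ℝ) : x ^ (2 * p) *
        ((2 / √π) * ((-1) ^ n / ((n.factorial : ℝ) * (2 * n + 1)) *
          ((α / 2) * √(4 - x ^ 2)) ^ (2 * n + 1)))
        = (2 / √π) * ((-1) ^ n / ((n.factorial : ℝ) * (2 * n + 1)) * (α / 2) ^ (2 * n + 1)) *
          (x ^ (2 * p) * √(4 - x ^ 2) ^ (2 * n + 1)) := by
      rw [mul_pow]
      ring
    simp_rw [hfactor]
    rw [intervalIntegral.integral_const_mul, integral_pow_mul_sqrt_four_sub_sq_pow,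
      neg_pow (α ^ 2), ← pow_mul, div_pow,
      show 2 * p + 2 * n + 2 = (2 * p + 1) + (2 * n + 1) by ring,
      pow_add (2 : ℝ) (2 * p + 1), pow_succ α]
    have hpi : √π * √π = π := Real.mul_self_sqrt Real.pi_pos.le
    have hsqrt : √π ≠ 0 := by positivity
    field_simp
    rw [pow_two, hpi]
  have hsum := ((hasSum_integral_pow_mul_erf α p).mul_left (1 / (2 * α * √π))).mul_left π
  simp_rw [hterm] at hsum
  refine ⟨hsum.summable.abs, ?_⟩
  rw [hsum.tsum_eq]
  field_simp
end

section
/- (The leading-order operator annihilates the limiting moment generating functions of the GinOE.) Define the linear differential operator 𝔇₀ by 𝔇₀[f](t) = 2t⁴f⁽⁷⁾(t) + 2t³f⁽⁶⁾(t) − (4t⁴+42t²)f⁽⁵⁾(t) + (4t³+120t)f⁽⁴⁾(t) + (2t⁴+36t²−120)f‴(t) − (6t³+120t)f″(t) + (6t²+120)f′(t). Then 𝔇₀[g](t) = 0 for all t ∈ ℝ where g(t) = cosh(t), and 𝔇₀[f](t) = 0 for all real t ≠ 0 where f(t) = sinh(t)/t. -/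
open Real

/-- The leading-order linear differential operator `𝔇₀` of the large-`N` expansion
of the GinOE moment generating function. -/
noncomputable def D0 (f : ℝ → ℝ) (t : ℝ) : ℝ :=
  2*t^4 * iteratedDeriv 7 f t + 2*t^3 * iteratedDeriv 6 f t
  - (4*t^4 + 42*t^2) * iteratedDeriv 5 f t + (4*t^3 + 120*t) * iteratedDeriv 4 f t
  + (2*t^4 + 36*t^2 - 120) * iteratedDeriv 3 f t - (6*t^3 + 120*t) * iteratedDeriv 2 f t
  + (6*t^2 + 120) * deriv f t

/-- Leibniz rule for the product of the identity with a smooth function. -/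
lemma iteratedDeriv_succ_fun_id_mul {f : ℝ → ℝ} {t : ℝ} {n : ℕ}
    (hf : ContDiffAt ℝ (n + 1 : ℕ) f t) :
    iteratedDeriv (n + 1) (fun s => s * f s) t =
      t * iteratedDeriv (n + 1) f t + (n + 1) * iteratedDeriv n f t := by
  rw [iteratedDeriv_fun_mul contDiffAt_fun_id hf, Finset.sum_range_succ', Finset.sum_range_succ']
  simp [iteratedDeriv_fun_id, add_comm]

lemma iteratedDeriv_succ_sinh_div_self {t : ℝ} (ht : t ≠ 0) (n : ℕ) :
    t * iteratedDeriv (n + 1) (fun s => sinh s / s) t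
      + (n + 1) * iteratedDeriv n (fun s => sinh s / s) t = iteratedDeriv n cosh t := by
  have hf : ContDiffAt ℝ (n + 1 : ℕ) (fun s => sinh s / s) t :=
    contDiff_sinh.contDiffAt.fun_div contDiffAt_fun_id ht
  rw [← iteratedDeriv_succ_fun_id_mul hf, ← iteratedDeriv_add_one_sinh]
  congr 1
  ext s
  rcases eq_or_ne s 0 with rfl | hs
  · simp
  · field_simp

/-- **Theorem.** `𝔇₀` annihilates `cosh t` on all of `ℝ` and `sinh t / t` away from `0`. -/
theorem D0_annihilates_limits :
    (∀ t : ℝ, D0 Real.cosh t = 0) ∧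
    (∀ t : ℝ, t ≠ 0 → D0 (fun s => Real.sinh s / s) t = 0) := by
  refine ⟨fun t => ?_, fun t ht => ?_⟩
  · simp only [D0, iteratedDeriv_add_one_cosh, iteratedDeriv_add_one_sinh, iteratedDeriv_zero,
      Real.deriv_cosh]
    ring
  · have h₀ : t * (sinh t / t) = sinh t := mul_div_cancel₀ _ ht
    have h := iteratedDeriv_succ_sinh_div_self ht
    have h₁ := h 0
    have h₂ := h 1
    have h₃ := h 2
    have h₄ := h 3
    have h₅ := h 4
    have h₆ := h 5
    have h₇ := h 6
    norm_num [iteratedDeriv_add_one_cosh, iteratedDeriv_add_one_sinh, iteratedDeriv_one]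
      at h₁ h₂ h₃ h₄ h₅ h₆ h₇
    unfold D0
    linear_combination 2 * t ^ 3 * h₇ - 12 * t ^ 2 * h₆ + (30 * t - 4 * t ^ 3) * h₅
      + (24 * t ^ 2 - 30) * h₄ + (2 * t ^ 3 - 60 * t) * h₃ + (60 - 12 * t ^ 2) * h₂
      + 30 * t * h₁ - 30 * h₀
end
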